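/- For all integers m ≥ k ≥ 2, B(m,k) ≥ ⌊k/2⌋·(m−k+1) + k − 1. Equivalently, player B has a strategy in the game B_{m,k} guaranteeing that, for every strategy of player A, among the first ⌊k/2⌋·(m−k+1) + k − 2 points played there is no m-up-run. -/

import Mathlib

open Set

/-- A point in the plane. -/
abbrev Pt : Type := ℝ × ℝ

/-- The point set `P` contains an `n`-up-run: `n` points with strictly increasing
`x`-coordinates and nondecreasing `y`-coordinates. -/
def HasUpRun (P : Set Pt) (n : ℕ) : Prop :=
  ∃ f : Fin n → Pt, (∀ i, f i ∈ P) ∧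
    StrictMono (fun i => (f i).1) ∧ Monotone (fun i => (f i).2)

/-- The point set `P` contains an `n`-down-run: `n` points with strictly increasing
`x`-coordinates and strictly decreasing `y`-coordinates. -/
def HasDownRun (P : Set Pt) (n : ℕ) : Prop :=
  ∃ f : Fin n → Pt, (∀ i, f i ∈ P) ∧
    StrictMono (fun i => (f i).1) ∧ StrictAnti (fun i => (f i).2)

/-- A strategy for player A: from the list of previously played points, choose
an x-coordinate. -/
abbrev AStrat : Type := List Pt → ℝ

/-- A strategy for player B: from the list of previously played points and the new
x-coordinate, choose a y-coordinate. -/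
abbrev BStrat : Type := List Pt → ℝ → ℝ

/-- Validity of a strategy for player A in either game: the chosen x-coordinate lies in
`(0,1)` and is distinct from all previously played x-coordinates. -/
def AValid (sA : AStrat) : Prop :=
  ∀ h : List Pt, sA h ∈ Ioo (0:ℝ) 1 ∧ ∀ p ∈ h, sA h ≠ p.1

/-- Validity of a strategy for player B in the game `A_{m,k}`: the chosen y-coordinate
lies in `(0,1)` and is distinct from all previously played y-coordinates. -/
def BValid (sB : BStrat) : Prop :=
  ∀ (h : List Pt) (x : ℝ), sB h x ∈ Ioo (0:ℝ) 1 ∧ ∀ p ∈ h, sB h x ≠ p.2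

/-- The list of points played in the first `n` turns when A plays `sA` and B plays `sB`. -/
def hist (sA : AStrat) (sB : BStrat) : ℕ → List Pt
  | 0 => []
  | n + 1 =>
      let h := hist sA sB n
      h ++ [(sA h, sB h (sA h))]

/-- The set of points played in the first `N` turns. -/
def played (sA : AStrat) (sB : BStrat) (N : ℕ) : Set Pt :=
  {p | p ∈ hist sA sB N}

/-- In the game `A_{m,k}`, strategy `sA` of player A is valid and guarantees an
`m`-up-run or a `k`-down-run among the first `N` points, against every valid
strategy of player B. -/
def AWinsBy (m k N : ℕ) (sA : AStrat) : Prop :=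
  AValid sA ∧ ∀ sB : BStrat, BValid sB →
    HasUpRun (played sA sB N) m ∨ HasDownRun (played sA sB N) k

/-- The Erdős–Szekeres on-line number `ESO(m,k)`: the least `N` such that player A
has a strategy forcing an `m`-up-run or a `k`-down-run within `N` turns. -/
noncomputable def ESO (m k : ℕ) : ℕ := sInf {N | ∃ sA : AStrat, AWinsBy m k N sA}

/-- Validity of a strategy for player B in the tier game `B_{m,k}`: the chosen
y-coordinate is an integer in `{1, …, k-1}` (repetitions allowed). -/
def BTierValid (k : ℕ) (sB : BStrat) : Prop :=
  ∀ (h : List Pt) (x : ℝ), ∃ j : ℕ, 1 ≤ j ∧ j ≤ k - 1 ∧ sB h x = (j : ℝ)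

/-- In the tier game `B_{m,k}`, strategy `sA` of player A is valid and guarantees an
`m`-up-run among the first `N` points, against every valid strategy of player B. -/
def AWinsTierBy (m k N : ℕ) (sA : AStrat) : Prop :=
  AValid sA ∧ ∀ sB : BStrat, BTierValid k sB → HasUpRun (played sA sB N) m

/-- `B(m,k)`: the least `N` such that player A has a strategy forcing an `m`-up-run
within `N` turns of the tier game `B_{m,k}`. -/
noncomputable def BNum (m k : ℕ) : ℕ := sInf {N | ∃ sA : AStrat, AWinsTierBy m k N sA}

lemma exists_mem_card_filter_le_eq (X : Finset ℝ) (r : ℕ) (hr : 1 ≤ r) (hX : r ≤ X.card) :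
    ∃ t ∈ X, (X.filter (fun y => y ≤ t)).card = r := by
  let e := X.orderEmbOfFin rfl
  let i : Fin X.card := ⟨r - 1, by omega⟩
  refine ⟨e i, X.orderEmbOfFin_mem rfl i, ?_⟩
  have h : X.filter (fun y => y ≤ e i) = (Finset.Iic i).map e.toEmbedding := by
    ext y
    simp only [Finset.mem_filter, Finset.mem_map, Finset.mem_Iic]
    constructor
    · rintro ⟨hy, hle⟩
      have : y ∈ Set.range e := by rw [Finset.range_orderEmbOfFin]; exact hy
      obtain ⟨a, rfl⟩ := this
      exact ⟨a, e.le_iff_le.1 hle, rfl⟩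
    · rintro ⟨a, ha, rfl⟩
      exact ⟨X.orderEmbOfFin_mem rfl a, e.le_iff_le.2 ha⟩
  rw [h, Finset.card_map, Fin.card_Iic]
  simp only [i]
  omega

/-- The set of points `S`, which contains the auxiliary corners `(0, 1)` and `(1, n)`, is cut
into consecutive vertical blocks indexed by the monotone map `β`, so that no two points of a
block have the same tier. -/
structure IsBlocking (n : ℕ) (β : ℝ → ℕ) (S : Finset Pt) : Prop where
  mono : Monotone β
  zero : β 0 = 0
  tier : ∀ p ∈ S, ∃ j : ℕ, 1 ≤ j ∧ j ≤ n ∧ p.2 = j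
  inj : ∀ p ∈ S, ∀ q ∈ S, β p.1 = β q.1 → p.2 = q.2 → p = q
  xinj : Set.InjOn Prod.fst (S : Set Pt)
  left_mem : ((0 : ℝ), (1 : ℝ)) ∈ S
  right_mem : ((1 : ℝ), (n : ℝ)) ∈ S
  range : ∀ p ∈ S, p.1 ∈ Icc (0 : ℝ) 1

/-- Either there is a single block or every block has at least `r` points. -/
def BlocksLarge (r : ℕ) (β : ℝ → ℕ) (S : Finset Pt) : Prop :=
  β 1 = 0 ∨ ∀ c ≤ β 1, r ≤ (S.filter (fun p => β p.1 = c)).card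

lemma exists_free_tier {n : ℕ} {H : Finset Pt} (hH : H.card < n) :
    ∃ j : ℕ, 1 ≤ j ∧ j ≤ n ∧ ∀ p ∈ H, p.2 ≠ j := by
  by_contra! hcon
  have hsub : (Finset.Icc 1 n).image (fun j : ℕ => (j : ℝ)) ⊆ H.image Prod.snd := by
    intro y hy
    simp only [Finset.mem_image, Finset.mem_Icc] at hy ⊢
    obtain ⟨j, ⟨h1, h2⟩, rfl⟩ := hy
    exact hcon j h1 h2
  have h1 := Finset.card_le_card hsub
  rw [Finset.card_image_of_injective _ Nat.cast_injective, Nat.card_Icc] at h1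
  have h2 : (H.image Prod.snd).card ≤ H.card := Finset.card_image_le
  omega

lemma IsBlocking.card_block_le {n : ℕ} {β : ℝ → ℕ} {S : Finset Pt} (h : IsBlocking n β S)
    (c : ℕ) : (S.filter (fun p => β p.1 = c)).card ≤ n := by
  have hsub : (S.filter (fun p => β p.1 = c)).image Prod.snd ⊆
      (Finset.Icc 1 n).image (fun j : ℕ => (j : ℝ)) := by
    intro y hy
    simp only [Finset.mem_image, Finset.mem_filter, Finset.mem_Icc] at hy ⊢
    obtain ⟨p, ⟨hp, -⟩, rfl⟩ := hy
    obtain ⟨j, h1, h2, h3⟩ := h.tier p hp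
    exact ⟨j, ⟨h1, h2⟩, h3.symm⟩
  have h1 := Finset.card_le_card hsub
  rw [Finset.card_image_of_injective _ Nat.cast_injective, Nat.card_Icc,
    Finset.card_image_of_injOn] at h1
  · omega
  · intro p hp q hq hpq
    simp only [Finset.coe_filter, Set.mem_ofPred_eq] at hp hq
    exact h.inj p hp.1 q hq.1 (hp.2.trans hq.2.symm) hpq

lemma IsBlocking.insert_point {n : ℕ} {β : ℝ → ℕ} {S : Finset Pt} (h : IsBlocking n β S) {x : ℝ}
    (hx : x ∈ Ioo (0 : ℝ) 1) (hxS : ∀ p ∈ S, x ≠ p.1) {j : ℕ} (hj1 : 1 ≤ j) (hjn : j ≤ n)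
    (hfree : ∀ p ∈ S, β p.1 = β x → p.2 ≠ j) :
    IsBlocking n β (insert (x, (j : ℝ)) S) where
  mono := h.mono
  zero := h.zero
  tier := by
    intro p hp
    rcases Finset.mem_insert.1 hp with rfl | hp
    · exact ⟨j, hj1, hjn, rfl⟩
    · exact h.tier p hp
  inj := by
    intro p hp q hq hβ h2
    rcases Finset.mem_insert.1 hp with rfl | hp <;> rcases Finset.mem_insert.1 hq with rfl | hq
    · rfl
    · exact absurd h2.symm (hfree q hq hβ.symm)
    · exact absurd h2 (hfree p hp hβ)
    · exact h.inj p hp q hq hβ h2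
  xinj := by
    intro p hp q hq h1
    rcases Finset.mem_insert.1 hp with rfl | hp <;> rcases Finset.mem_insert.1 hq with rfl | hq
    · rfl
    · exact absurd h1 (hxS q hq)
    · exact absurd h1.symm (hxS p hp)
    · exact h.xinj hp hq h1
  left_mem := Finset.mem_insert_of_mem h.left_mem
  right_mem := Finset.mem_insert_of_mem h.right_mem
  range := by
    intro p hp
    rcases Finset.mem_insert.1 hp with rfl | hp
    · exact Ioo_subset_Icc_self hx
    · exact h.range p hp

/-- The labelling obtained from `β` by splitting block `c` at the threshold `t`. -/
noncomputable def splitBlock (β : ℝ → ℕ) (c : ℕ) (t : ℝ) (y : ℝ) : ℕ :=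
  if β y < c ∨ (β y = c ∧ y ≤ t) then β y else β y + 1

lemma splitBlock_monotone {β : ℝ → ℕ} (hβ : Monotone β) (c : ℕ) (t : ℝ) :
    Monotone (splitBlock β c t) := by
  intro y z hyz
  have := hβ hyz
  unfold splitBlock
  split_ifs with h1 h2 h2
  · exact this
  · omega
  · have hne : β y ≠ β z := by
      intro heq
      rcases h2 with h2 | h2
      · exact h1 (Or.inl (by omega))
      · exact h1 (Or.inr ⟨by omega, hyz.trans h2.2⟩)
    omega
  · omega

/-- Splitting a block refines the partition. -/
lemma eq_of_splitBlock_eq {β : ℝ → ℕ} {c : ℕ} {t y z : ℝ}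
    (h : splitBlock β c t y = splitBlock β c t z) : β y = β z := by
  unfold splitBlock at h
  split_ifs at h with h1 h2 h2 <;> omega

lemma IsBlocking.split {n : ℕ} {β : ℝ → ℕ} {S : Finset Pt} (h : IsBlocking n β S) (c : ℕ)
    {t : ℝ} (ht : 0 ≤ t) : IsBlocking n (splitBlock β c t) S where
  mono := splitBlock_monotone h.mono c t
  zero := by
    have h0 := h.zero
    unfold splitBlock
    rw [if_pos, h0]
    rw [h0]
    rcases Nat.eq_zero_or_pos c with hc | hc
    · exact Or.inr ⟨hc.symm, ht⟩
    · exact Or.inl hc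
  tier := h.tier
  inj := fun p hp q hq hβ => h.inj p hp q hq (eq_of_splitBlock_eq hβ)
  xinj := h.xinj
  left_mem := h.left_mem
  right_mem := h.right_mem
  range := h.range

/-- A freshly chosen vertical line admits a tier keeping the points blocked: if its block is full,
the block is first split into halves. -/
lemma IsBlocking.exists_insert {n r : ℕ} {β : ℝ → ℕ} {S : Finset Pt} (h : IsBlocking n β S)
    (hr : 1 ≤ r) (hrn : 2 * r ≤ n + 1) (hn : 2 ≤ n) (hlarge : BlocksLarge r β S) {x : ℝ}
    (hx : x ∈ Ioo (0 : ℝ) 1) (hxS : ∀ p ∈ S, x ≠ p.1) :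
    ∃ j : ℕ, 1 ≤ j ∧ j ≤ n ∧ ∃ β' : ℝ → ℕ, IsBlocking n β' (insert (x, (j : ℝ)) S) ∧
      BlocksLarge r β' (insert (x, (j : ℝ)) S) := by
  set T := S.filter (fun p => β p.1 = β x) with hT
  rcases (h.card_block_le (β x)).lt_or_eq with hlt | hfull
  · obtain ⟨j, hj1, hjn, hj⟩ := exists_free_tier hlt
    refine ⟨j, hj1, hjn, β, h.insert_point hx hxS hj1 hjn
      (fun p hp hpx => hj p (Finset.mem_filter.2 ⟨hp, hpx⟩)), ?_⟩
    rcases hlarge with h0 | h1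
    · exact Or.inl h0
    · exact Or.inr fun c hc => (h1 c hc).trans
        (Finset.card_le_card (Finset.filter_subset_filter _ (Finset.subset_insert _ _)))
  · set X := insert x (T.image Prod.fst) with hX
    have hxT : x ∉ T.image Prod.fst := by
      simp only [Finset.mem_image, not_exists, not_and]
      exact fun p hp hpx => hxS p (Finset.mem_filter.1 hp).1 hpx.symm
    have hTinj : Set.InjOn Prod.fst (T : Set Pt) :=
      h.xinj.mono (by exact_mod_cast Finset.filter_subset _ _)
    have hXcard : X.card = n + 1 := by
      rw [hX, Finset.card_insert_of_notMem hxT, Finset.card_image_of_injOn hTinj, hT, hfull]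
    have hXrange : ∀ y ∈ X, y ∈ Icc (0 : ℝ) 1 := by
      intro y hy
      rcases Finset.mem_insert.1 hy with rfl | hy
      · exact Ioo_subset_Icc_self hx
      · obtain ⟨p, hp, rfl⟩ := Finset.mem_image.1 hy
        exact h.range p (Finset.mem_filter.1 hp).1
    obtain ⟨t, htX, htr⟩ := exists_mem_card_filter_le_eq X r hr (by omega)
    have htr' : (X.filter (fun y => ¬ y ≤ t)).card = n + 1 - r := by
      have := Finset.card_filter_add_card_filter_not (s := X) (fun y => y ≤ t)
      omega
    have ht1 : t < 1 := by
      obtain ⟨y, hy⟩ : (X.filter (fun y => ¬ y ≤ t)).Nonempty := by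
        rw [← Finset.card_pos]; omega
      rw [Finset.mem_filter] at hy
      exact (not_le.1 hy.2).trans_le (hXrange y hy.1).2
    set β' := splitBlock β (β x) t with hβ'
    have hblk := h.split (β x) (hXrange t htX).1
    have hH : (S.filter (fun p => β' p.1 = β' x)).card < n := by
      set H := S.filter (fun p => β' p.1 = β' x)
      have hHT : ∀ p ∈ H, p.1 ∈ X ∧ (p.1 ≤ t ↔ x ≤ t) := by
        intro p hp
        obtain ⟨hpS, hpx⟩ := Finset.mem_filter.1 hp
        have hb : β p.1 = β x := eq_of_splitBlock_eq hpx
        refine ⟨Finset.mem_insert_of_mem (Finset.mem_image_of_mem _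
          (Finset.mem_filter.2 ⟨hpS, hb⟩)), ?_⟩
        simp only [hβ', splitBlock, hb, lt_irrefl, false_or, true_and] at hpx
        split_ifs at hpx with h1 h2 h2
        · tauto
        · omega
        · omega
        · tauto
      have hxH : x ∉ H.image Prod.fst := by
        simp only [Finset.mem_image, not_exists, not_and]
        exact fun p hp hpx => hxS p (Finset.mem_filter.1 hp).1 hpx.symm
      have hsub : insert x (H.image Prod.fst) ⊆ X.filter (fun y => y ≤ t ↔ x ≤ t) := by
        intro y hy
        rw [Finset.mem_filter]
        rcases Finset.mem_insert.1 hy with rfl | hy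
        · exact ⟨Finset.mem_insert_self _ _, Iff.rfl⟩
        · obtain ⟨p, hp, rfl⟩ := Finset.mem_image.1 hy
          exact hHT p hp
      have hle := Finset.card_le_card hsub
      rw [Finset.card_insert_of_notMem hxH, Finset.card_image_of_injOn
        (h.xinj.mono (by exact_mod_cast Finset.filter_subset _ _))] at hle
      by_cases hxt : x ≤ t
      · simp only [hxt, iff_true] at hle
        omega
      · simp only [hxt, iff_false] at hle
        omega
    obtain ⟨j, hj1, hjn, hj⟩ := exists_free_tier hH
    have hins := hblk.insert_point hx hxS hj1 hjn
      (fun p hp hpx => hj p (Finset.mem_filter.2 ⟨hp, hpx⟩))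
    refine ⟨j, hj1, hjn, β', hins, Or.inr ?_⟩
    have hβ1 : β' 1 = β 1 + 1 := by
      have hle : β x ≤ β 1 := h.mono hx.2.le
      simp only [hβ', splitBlock]
      rw [if_neg]
      rintro (h1 | h1)
      · omega
      · linarith [h1.2]
    intro c hc
    rw [hβ1] at hc
    have hXS : ∀ y ∈ X, β y = β x ∧ ∃ p ∈ insert (x, (j : ℝ)) S, p.1 = y := by
      intro y hy
      rcases Finset.mem_insert.1 hy with rfl | hy
      · exact ⟨rfl, _, Finset.mem_insert_self _ _, rfl⟩
      · obtain ⟨p, hp, rfl⟩ := Finset.mem_image.1 hy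
        obtain ⟨hp, hpx⟩ := Finset.mem_filter.1 hp
        exact ⟨hpx, p, Finset.mem_insert_of_mem hp, rfl⟩
    have hlow : c ≠ β x → c ≠ β x + 1 → r ≤ ((insert (x, (j : ℝ)) S).filter
        (fun p => β' p.1 = c)).card := by
      intro hc1 hc2
      have hle : β x ≤ β 1 := h.mono hx.2.le
      rcases hlarge with h0 | h1
      · omega
      · rcases lt_or_gt_of_ne hc1 with hlt | hgt
        · refine (h1 c (by omega)).trans (Finset.card_le_card ?_)
          intro p hp
          obtain ⟨hp, hpc⟩ := Finset.mem_filter.1 hp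
          refine Finset.mem_filter.2 ⟨Finset.mem_insert_of_mem hp, ?_⟩
          simp only [hβ', splitBlock]
          rw [if_pos (Or.inl (by omega)), hpc]
        · refine (h1 (c - 1) (by omega)).trans (Finset.card_le_card ?_)
          intro p hp
          obtain ⟨hp, hpc⟩ := Finset.mem_filter.1 hp
          refine Finset.mem_filter.2 ⟨Finset.mem_insert_of_mem hp, ?_⟩
          simp only [hβ', splitBlock]
          rw [if_neg (by omega)]
          omega
    by_cases hc1 : c = β x
    · calc r = (X.filter (fun y => y ≤ t)).card := htr.symm
        _ ≤ (((insert (x, (j : ℝ)) S).filter (fun p => β' p.1 = c)).image Prod.fst).card := by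
          refine Finset.card_le_card ?_
          intro y hy
          obtain ⟨hy, hyt⟩ := Finset.mem_filter.1 hy
          obtain ⟨hb, p, hp, rfl⟩ := hXS y hy
          refine Finset.mem_image_of_mem _ (Finset.mem_filter.2 ⟨hp, ?_⟩)
          simp only [hβ', splitBlock]
          rw [if_pos (Or.inr ⟨hb, hyt⟩), hb, hc1]
        _ ≤ _ := Finset.card_image_le
    · by_cases hc2 : c = β x + 1
      · calc r ≤ (X.filter (fun y => ¬ y ≤ t)).card := by omega
          _ ≤ (((insert (x, (j : ℝ)) S).filter (fun p => β' p.1 = c)).image Prod.fst).card := by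
            refine Finset.card_le_card ?_
            intro y hy
            obtain ⟨hy, hyt⟩ := Finset.mem_filter.1 hy
            obtain ⟨hb, p, hp, rfl⟩ := hXS y hy
            refine Finset.mem_image_of_mem _ (Finset.mem_filter.2 ⟨hp, ?_⟩)
            simp only [hβ', splitBlock]
            rw [if_neg (by rintro (h1 | h1); exacts [by omega, hyt h1.2]), hb, hc2]
          _ ≤ _ := Finset.card_image_le
      · exact hlow hc1 hc2

lemma BlocksLarge.mul_le_card {r : ℕ} {β : ℝ → ℕ} {S : Finset Pt} (h : BlocksLarge r β S)
    (h1 : β 1 ≠ 0) : (β 1 + 1) * r ≤ S.card := by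
  have h2 := h.resolve_left h1
  have h3 := Finset.card_nsmul_le_sum (Finset.range (β 1 + 1))
    (fun c => (S.filter (fun p => β p.1 = c)).card) r
    (fun c hc => h2 c (Nat.lt_succ_iff.1 (Finset.mem_range.1 hc)))
  rw [Finset.card_range, smul_eq_mul] at h3
  refine h3.trans ?_
  rw [← Finset.card_biUnion]
  · exact Finset.card_le_card (Finset.biUnion_subset.2 fun c _ => Finset.filter_subset _ _)
  · intro c _ d _ hcd
    rw [Function.onFun, Finset.disjoint_left]
    intro p hp hq
    exact hcd ((Finset.mem_filter.1 hp).2.symm.trans (Finset.mem_filter.1 hq).2)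

/-- Along an up-run, block index plus tier strictly increases, also when compared with the two
corners. -/
lemma IsBlocking.upRun_length_le {n m : ℕ} {β : ℝ → ℕ} {S : Finset Pt} (h : IsBlocking n β S)
    {P : Set Pt} (hP : ∀ p ∈ P, p ∈ S ∧ p.1 ∈ Ioo (0 : ℝ) 1) (hrun : HasUpRun P m) :
    m ≤ β 1 + n - 2 := by
  obtain ⟨f, hfP, hx, hy⟩ := hrun
  have key : ∀ p ∈ S, ∀ q ∈ S, p.1 < q.1 → p.2 ≤ q.2 →
      β p.1 + ⌊p.2⌋₊ < β q.1 + ⌊q.2⌋₊ := by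
    intro p hp q hq hpq h2
    have hb := h.mono hpq.le
    have hf := Nat.floor_mono h2
    by_contra hcon
    have hb' : β p.1 = β q.1 := by omega
    have hf' : ⌊p.2⌋₊ = ⌊q.2⌋₊ := by omega
    obtain ⟨i, -, -, hi⟩ := h.tier p hp
    obtain ⟨j, -, -, hj⟩ := h.tier q hq
    rw [hi, hj, Nat.floor_natCast, Nat.floor_natCast] at hf'
    have := h.inj p hp q hq hb' (by rw [hi, hj, hf'])
    rw [this] at hpq
    exact lt_irrefl _ hpq
  have hmono : StrictMono (fun i => β (f i).1 + ⌊(f i).2⌋₊) := fun i j hij =>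
    key _ (hP _ (hfP i)).1 _ (hP _ (hfP j)).1 (hx hij) (hy hij.le)
  have hmem : ∀ i ∈ (Finset.univ : Finset (Fin m)),
      β (f i).1 + ⌊(f i).2⌋₊ ∈ Finset.Ioo 1 (β 1 + n) := by
    intro i _
    obtain ⟨hS, h0, h1⟩ := hP _ (hfP i)
    obtain ⟨j, hj1, hjn, hj⟩ := h.tier _ hS
    have ha := key _ h.left_mem _ hS h0 (hj ▸ Nat.one_le_cast.2 hj1)
    have hb := key _ hS _ h.right_mem h1 (hj ▸ Nat.cast_le.2 hjn)
    simp only [h.zero, Nat.floor_one, Nat.floor_natCast, zero_add] at ha hb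
    exact Finset.mem_Ioo.2 ⟨ha, hb⟩
  have := Finset.card_le_card_of_injOn _ hmem hmono.injective.injOn
  rw [Finset.card_univ, Fintype.card_fin, Nat.card_Ioo] at this
  omega

/-- The points of a history together with the two auxiliary corners. -/
noncomputable def cornered (n : ℕ) (h : List Pt) : Finset Pt :=
  insert ((0 : ℝ), (1 : ℝ)) (insert ((1 : ℝ), (n : ℝ)) h.toFinset)

lemma cornered_append (n : ℕ) (h : List Pt) (p : Pt) :
    cornered n (h ++ [p]) = insert p (cornered n h) := by
  ext q
  simp only [cornered, Finset.mem_insert, List.mem_toFinset, List.mem_append, List.mem_singleton]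
  tauto

lemma card_cornered_le (n : ℕ) (h : List Pt) : (cornered n h).card ≤ h.length + 2 := by
  have h1 := Finset.card_insert_le ((0 : ℝ), (1 : ℝ)) (insert ((1 : ℝ), (n : ℝ)) h.toFinset)
  have h2 := Finset.card_insert_le ((1 : ℝ), (n : ℝ)) h.toFinset
  have h3 := h.toFinset_card_le
  unfold cornered
  omega

/-- A history whose cornered point set can be cut into large blocks. -/
def WellBlocked (n r : ℕ) (h : List Pt) : Prop :=
  ∃ β : ℝ → ℕ, IsBlocking n β (cornered n h) ∧ BlocksLarge r β (cornered n h)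

lemma wellBlocked_nil {n : ℕ} (hn : 2 ≤ n) (r : ℕ) : WellBlocked n r [] := by
  have hn' : (1 : ℝ) ≠ n := by
    intro h
    have : (1 : ℕ) = n := by exact_mod_cast h
    omega
  have hmem : ∀ p : Pt, p ∈ cornered n [] ↔ p = (0, 1) ∨ p = (1, (n : ℝ)) := by
    intro p
    simp [cornered]
  refine ⟨fun _ => 0, ⟨monotone_const, rfl, ?_, ?_, ?_, (hmem _).2 (Or.inl rfl),
    (hmem _).2 (Or.inr rfl), ?_⟩, Or.inl rfl⟩
  · intro p hp
    rcases (hmem p).1 hp with rfl | rfl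
    · exact ⟨1, le_rfl, by omega, by simp⟩
    · exact ⟨n, by omega, le_rfl, rfl⟩
  · intro p hp q hq _ h2
    rcases (hmem p).1 hp with rfl | rfl <;> rcases (hmem q).1 hq with rfl | rfl
    · rfl
    · exact absurd h2 hn'
    · exact absurd h2.symm hn'
    · rfl
  · intro p hp q hq h1
    rcases (hmem p).1 hp with rfl | rfl <;> rcases (hmem q).1 hq with rfl | rfl
    · rfl
    · exact absurd h1 zero_ne_one
    · exact absurd h1 one_ne_zero
    · rfl
  · intro p hp
    rcases (hmem p).1 hp with rfl | rfl
    · exact ⟨le_rfl, zero_le_one⟩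
    · exact ⟨zero_le_one, le_rfl⟩

lemma WellBlocked.exists_append {n r : ℕ} {h : List Pt} (hw : WellBlocked n r h)
    (hr : 1 ≤ r) (hrn : 2 * r ≤ n + 1) (hn : 2 ≤ n) {x : ℝ} (hx : x ∈ Ioo (0 : ℝ) 1)
    (hxh : ∀ p ∈ h, x ≠ p.1) :
    ∃ j : ℕ, 1 ≤ j ∧ j ≤ n ∧ WellBlocked n r (h ++ [(x, (j : ℝ))]) := by
  obtain ⟨β, hβ, hlarge⟩ := hw
  have hxS : ∀ p ∈ cornered n h, x ≠ p.1 := by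
    intro p hp
    simp only [cornered, Finset.mem_insert, List.mem_toFinset] at hp
    rcases hp with rfl | rfl | hp
    · exact hx.1.ne'
    · exact hx.2.ne
    · exact hxh p hp
  obtain ⟨j, hj1, hjn, hw⟩ := hβ.exists_insert hr hrn hn hlarge hx hxS
  refine ⟨j, hj1, hjn, ?_⟩
  unfold WellBlocked
  rw [cornered_append]
  exact hw

open Classical in
/-- Player B keeps the history well blocked whenever that is possible. -/
noncomputable def blockStrat (n r : ℕ) : BStrat := fun h x =>
  if hj : ∃ j : ℕ, 1 ≤ j ∧ j ≤ n ∧ WellBlocked n r (h ++ [(x, (j : ℝ))]) then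
    (hj.choose : ℝ) else 1

lemma blockStrat_tierValid {k : ℕ} (hk : 2 ≤ k) (r : ℕ) :
    BTierValid k (blockStrat (k - 1) r) := by
  intro h x
  unfold blockStrat
  split_ifs with hj
  · exact ⟨_, hj.choose_spec.1, hj.choose_spec.2.1, rfl⟩
  · exact ⟨1, le_rfl, by omega, by simp⟩

lemma wellBlocked_hist {n r : ℕ} (hr : 1 ≤ r) (hrn : 2 * r ≤ n + 1) (hn : 2 ≤ n)
    {sA : AStrat} (hA : AValid sA) (N : ℕ) :
    WellBlocked n r (hist sA (blockStrat n r) N) := by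
  induction N with
  | zero => exact wellBlocked_nil hn r
  | succ N ih =>
    have hj := ih.exists_append hr hrn hn (hA _).1 (hA _).2
    have heq : blockStrat n r (hist sA (blockStrat n r) N)
        (sA (hist sA (blockStrat n r) N)) = (hj.choose : ℝ) := dif_pos hj
    simp only [hist]
    rw [heq]
    exact hj.choose_spec.2.2

lemma length_hist (sA : AStrat) (sB : BStrat) (N : ℕ) : (hist sA sB N).length = N := by
  induction N with
  | zero => rfl
  | succ N ih => simp [hist, ih]

lemma played_mono (sA : AStrat) (sB : BStrat) : Monotone (played sA sB) :=
  monotone_nat_of_le_succ fun N p hp => by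
    simp only [played, Set.mem_ofPred_eq, hist] at hp ⊢
    exact List.mem_append_left _ hp

lemma HasUpRun.mono {P Q : Set Pt} (hPQ : P ⊆ Q) {m : ℕ} (h : HasUpRun P m) : HasUpRun Q m := by
  obtain ⟨f, hf, hx, hy⟩ := h
  exact ⟨f, fun i => hPQ (hf i), hx, hy⟩

lemma fst_mem_Ioo_of_mem_hist {sA : AStrat} (hA : AValid sA) (sB : BStrat) (N : ℕ) :
    ∀ p ∈ hist sA sB N, p.1 ∈ Ioo (0 : ℝ) 1 := by
  induction N with
  | zero => simp [hist]
  | succ N ih =>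
    intro p hp
    simp only [hist, List.mem_append, List.mem_singleton] at hp
    rcases hp with hp | rfl
    · exact ih p hp
    · exact (hA _).1

lemma HasUpRun.le_of_played {sA : AStrat} {sB : BStrat} {N m : ℕ}
    (h : HasUpRun (played sA sB N) m) : m ≤ N := by
  obtain ⟨f, hf, hx, -⟩ := h
  have hinj : Function.Injective f := fun i j hij => hx.injective (congrArg Prod.fst hij)
  have h1 := Finset.card_le_card_of_injOn (s := Finset.univ) (t := (hist sA sB N).toFinset) f
    (fun i _ => List.mem_toFinset.2 (hf i)) hinj.injOn
  have h2 := (hist sA sB N).toFinset_card_le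
  rw [length_hist] at h2
  simpa using h1.trans h2

lemma exists_aValid : ∃ sA : AStrat, AValid sA := by
  have h : ∀ l : List Pt, ∃ x : ℝ, x ∈ Ioo (0 : ℝ) 1 ∧ ∀ p ∈ l, x ≠ p.1 := by
    intro l
    obtain ⟨x, hx, hxl⟩ := (Ioo_infinite (zero_lt_one (α := ℝ))).exists_notMem_finset
      (l.toFinset.image Prod.fst)
    refine ⟨x, hx, fun p hp hpx => hxl ?_⟩
    rw [hpx]
    exact Finset.mem_image_of_mem _ (List.mem_toFinset.2 hp)
  choose sA hsA using h
  exact ⟨sA, hsA⟩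

lemma nodup_map_fst_hist {sA : AStrat} (hA : AValid sA) (sB : BStrat) (N : ℕ) :
    ((hist sA sB N).map Prod.fst).Nodup := by
  induction N with
  | zero => simp [hist]
  | succ N ih =>
    simp only [hist, List.map_append, List.map_cons, List.map_nil]
    refine List.Nodup.append ih (List.nodup_singleton _) ?_
    rw [List.disjoint_singleton]
    intro hmem
    obtain ⟨p, hp, hpx⟩ := List.mem_map.1 hmem
    exact (hA _).2 p hp hpx.symm

/-- Points on a common tier form an up-run, so every valid strategy of player A eventually
wins. -/
lemma exists_aWinsTierBy (m k : ℕ) : ∃ N, ∃ sA : AStrat, AWinsTierBy m k N sA := by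
  obtain ⟨sA, hA⟩ := exists_aValid
  refine ⟨(k - 1) * m + 1, sA, hA, fun sB hB => ?_⟩
  set N := (k - 1) * m + 1
  set l := hist sA sB N
  have hnodup := nodup_map_fst_hist hA sB N
  have hcard : l.toFinset.card = N := by
    rw [List.toFinset_card_of_nodup hnodup.of_map, length_hist]
  have htier : ∀ p ∈ l.toFinset, p.2 ∈ (Finset.Icc 1 (k - 1)).image (fun j : ℕ => (j : ℝ)) := by
    have : ∀ M, ∀ p ∈ hist sA sB M,
        p.2 ∈ (Finset.Icc 1 (k - 1)).image (fun j : ℕ => (j : ℝ)) := by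
      intro M
      induction M with
      | zero => simp [hist]
      | succ M ih =>
        intro p hp
        simp only [hist, List.mem_append, List.mem_singleton] at hp
        rcases hp with hp | rfl
        · exact ih p hp
        · obtain ⟨j, h1, h2, h3⟩ := hB (hist sA sB M) (sA (hist sA sB M))
          exact Finset.mem_image.2 ⟨j, Finset.mem_Icc.2 ⟨h1, h2⟩, h3.symm⟩
    exact fun p hp => this N p (List.mem_toFinset.1 hp)
  obtain ⟨y, -, hy⟩ := Finset.exists_lt_card_fiber_of_mul_lt_card_of_maps_to (n := m) htier (by
    rw [hcard, Finset.card_image_of_injective _ Nat.cast_injective, Nat.card_Icc,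
      Nat.add_sub_cancel]
    exact Nat.lt_succ_self _)
  set F := l.toFinset.filter (fun p => p.2 = y)
  have hFinj : Set.InjOn Prod.fst (F : Set Pt) := by
    intro p hp q hq hpq
    have hp' := List.mem_toFinset.1 (Finset.mem_filter.1 (Finset.mem_coe.1 hp)).1
    have hq' := List.mem_toFinset.1 (Finset.mem_filter.1 (Finset.mem_coe.1 hq)).1
    exact List.inj_on_of_nodup_map hnodup hp' hq' hpq
  have hXcard : m ≤ (F.image Prod.fst).card := by
    rw [Finset.card_image_of_injOn hFinj]
    exact hy.le
  let e := (F.image Prod.fst).orderEmbOfCardLe hXcard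
  refine ⟨fun i => (e i, y), fun i => ?_, fun i j hij => e.strictMono hij,
    fun i j _ => le_rfl⟩
  obtain ⟨p, hp, hpe⟩ := Finset.mem_image.1 (Finset.orderEmbOfCardLe_mem _ hXcard i)
  obtain ⟨hpl, hpy⟩ := Finset.mem_filter.1 hp
  have hp_eq : p = (e i, y) := Prod.ext hpe hpy
  change (e i, y) ∈ played sA sB N
  rw [← hp_eq]
  exact List.mem_toFinset.1 hpl

lemma blockStrat_not_hasUpRun {m k : ℕ} (hk : 2 ≤ k) (hkm : k ≤ m) {sA : AStrat}
    (hA : AValid sA) :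
    ¬ HasUpRun (played sA (blockStrat (k - 1) (k / 2)) (k / 2 * (m - k + 1) + k - 2)) m := by
  intro hrun
  rcases lt_or_ge k 4 with hk4 | hk4
  · have h1 := hrun.le_of_played
    have hr : k / 2 = 1 := by omega
    rw [hr] at h1
    omega
  · set N := k / 2 * (m - k + 1) + k - 2 with hN
    obtain ⟨β, hβ, hlarge⟩ := wellBlocked_hist (n := k - 1) (r := k / 2) (by omega) (by omega)
      (by omega) hA N
    have hm := hβ.upRun_length_le (fun p hp => ⟨Finset.mem_insert_of_mem
      (Finset.mem_insert_of_mem (List.mem_toFinset.2 hp)),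
      fst_mem_Ioo_of_mem_hist hA _ N p hp⟩) hrun
    have hcard := card_cornered_le (k - 1) (hist sA (blockStrat (k - 1) (k / 2)) N)
    rw [length_hist] at hcard
    have hmul := (hlarge.mul_le_card (by omega)).trans hcard
    have h3 : (m - k + 1 + 3) * (k / 2) ≤ (β 1 + 1) * (k / 2) :=
      Nat.mul_le_mul_right _ (by omega)
    have h4 : (m - k + 1 + 3) * (k / 2) = k / 2 * (m - k + 1) + 3 * (k / 2) := by ring
    omega

theorem BNum_lower (m k : ℕ) (hk : 2 ≤ k) (hkm : k ≤ m) :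
    k / 2 * (m - k + 1) + k - 1 ≤ BNum m k ∧
    ∃ sB : BStrat, BTierValid k sB ∧ ∀ sA : AStrat, AValid sA →
      ¬ HasUpRun (played sA sB (k / 2 * (m - k + 1) + k - 2)) m := by
  refine ⟨le_csInf (exists_aWinsTierBy m k) ?_, blockStrat (k - 1) (k / 2),
    blockStrat_tierValid hk _, fun sA hA => blockStrat_not_hasUpRun hk hkm hA⟩
  rintro N ⟨sA, hA, hwin⟩
  by_contra hlt
  exact blockStrat_not_hasUpRun hk hkm hA
    ((hwin _ (blockStrat_tierValid hk _)).mono (played_mono _ _ (by omega)))
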